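/- Let 0 < α < 3, 2 < p < 6, max{2, 6−2α} < q < ∞ with conjugate exponents p′ = p/(p−1), q′ = q/(q−1), let C > 0, and let Γ : ℝ³ → (0,∞) be measurable with Γ(x) ≤ C(1+|x|)^{−α} for almost every x. Let K(z) = (4π|z|)^{−1}. Then there exists a constant C″ > 0 such that for every measurable P : ℝ³ → ℝ³ with ‖Γ^{−1/p}P‖_{L^{p′}} + ‖Γ^{−1/q}P‖_{L^{q′}} < ∞, the componentwise convolution K ∗ P is defined almost everywhere and can be written as K ∗ P = E₁ + E₂ with measurable E₁, E₂ : ℝ³ → ℝ³ satisfying ‖Γ^{1/p}E₁‖_{L^p} + ‖Γ^{1/q}E₂‖_{L^q} ≤ C″·( ‖Γ^{−1/p}P‖_{L^{p′}} + ‖Γ^{−1/q}P‖_{L^{q′}} ). -/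

import Mathlib

open Set MeasureTheory ENNReal

abbrev E3 := EuclideanSpace ℝ (Fin 3)

lemma young_aux (t : ℝ) (ht : 2 < t) (k f : E3 → ℝ≥0∞) (hk : Measurable k) (hf : Measurable f) :
    ∫⁻ x, (∫⁻ y, k (x - y) * f y) ^ t ≤
      (∫⁻ x, k x ^ (t / 2)) ^ (2:ℕ) * (∫⁻ x, f x ^ (t / (t - 1))) ^ (t - 1) := by
  set m := t / 2 with hm
  set s := t / (t - 1) with hs
  have ht0 : 0 < t := by linarith
  have ht1 : 0 < t - 1 := by linarith
  have hkt : ∀ x : E3, Measurable fun y => k (x - y) := fun x => hk.comp (by fun_prop)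
  set I := ∫⁻ x, k x ^ m with hI
  set J := ∫⁻ x, f x ^ s with hJ
  have hIx : ∀ x : E3, ∫⁻ y, k (x - y) ^ m = I := fun x =>
    lintegral_sub_left_eq_self (fun z => k z ^ m) x
  have hIy : ∀ y : E3, ∫⁻ x, k (x - y) ^ m = I := fun y =>
    lintegral_sub_right_eq_self (fun z => k z ^ m) y
  have key : ∀ x : E3, (∫⁻ y, k (x - y) * f y) ^ t ≤
      (∫⁻ y, k (x - y) ^ m * f y ^ s) * (I * J ^ (t - 2)) := by
    intro x
    have h3 : ∀ y, k (x - y) * f y =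
        (k (x - y) ^ m * f y ^ s) ^ (1 / t) * ∏ i ∈ (Finset.univ : Finset (Fin 2)),
          (![fun y => k (x - y) ^ m, fun y => f y ^ s] i y) ^ (![1 / t, (t - 2) / t] i) := by
      intro y
      simp only [Fin.prod_univ_two, Matrix.cons_val_zero, Matrix.cons_val_one]
      rw [ENNReal.mul_rpow_of_nonneg _ _ (by positivity)]
      simp only [← ENNReal.rpow_mul]
      have e1 : k (x - y) ^ (m * (1 / t)) * k (x - y) ^ (m * (1 / t)) = k (x - y) := by
        rw [← ENNReal.rpow_add_of_nonneg _ _ (by positivity) (by positivity)]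
        have : m * (1 / t) + m * (1 / t) = 1 := by rw [hm]; field_simp; norm_num
        rw [this, ENNReal.rpow_one]
      have hs0 : 0 < s := by positivity
      have e2 : f y ^ (s * (1 / t)) * f y ^ (s * ((t - 2) / t)) = f y := by
        rw [← ENNReal.rpow_add_of_nonneg _ _ (by positivity)
          (mul_nonneg hs0.le (div_nonneg (by linarith) ht0.le))]
        have : s * (1 / t) + s * ((t - 2) / t) = 1 := by rw [hs]; field_simp; ring
        rw [this, ENNReal.rpow_one]
      calc k (x - y) * f y = (k (x - y) ^ (m * (1 / t)) * k (x - y) ^ (m * (1 / t))) *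
            (f y ^ (s * (1 / t)) * f y ^ (s * ((t - 2) / t))) := by rw [e1, e2]
        _ = _ := by ring
    have h4 : ∫⁻ y, k (x - y) * f y ≤ (∫⁻ y, k (x - y) ^ m * f y ^ s) ^ (1 / t) *
        ∏ i ∈ (Finset.univ : Finset (Fin 2)),
          (∫⁻ y, (![fun y => k (x - y) ^ m, fun y => f y ^ s] i y)) ^ (![1 / t, (t - 2) / t] i) := by
      simp_rw [h3]
      apply ENNReal.lintegral_mul_prod_norm_pow_le
      · exact (((hkt x).pow_const m).mul (hf.pow_const s)).aemeasurable
      · intro i _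
        fin_cases i
        · exact ((hkt x).pow_const m).aemeasurable
        · exact (hf.pow_const s).aemeasurable
      · simp only [Fin.sum_univ_two, Matrix.cons_val_zero, Matrix.cons_val_one]
        field_simp; ring
      · positivity
      · intro i _
        fin_cases i
        · simp; positivity
        · simp; exact div_nonneg (by linarith) ht0.le
    simp only [Fin.prod_univ_two, Matrix.cons_val_zero, Matrix.cons_val_one] at h4
    rw [hIx] at h4
    calc _ ≤ _ := ENNReal.rpow_le_rpow h4 ht0.le
      _ = _ := by
        rw [ENNReal.mul_rpow_of_nonneg _ _ ht0.le, ENNReal.mul_rpow_of_nonneg _ _ ht0.le]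
        simp only [← ENNReal.rpow_mul]
        rw [one_div_mul_cancel ht0.ne', div_mul_cancel₀ _ ht0.ne']
        simp [hJ]
  have hprod : Measurable fun z : E3 × E3 => k (z.1 - z.2) ^ m * f z.2 ^ s :=
    ((hk.comp (measurable_fst.sub measurable_snd)).pow_const m).mul
      ((hf.comp measurable_snd).pow_const s)
  calc _ ≤ ∫⁻ x, (∫⁻ y, k (x - y) ^ m * f y ^ s) * (I * J ^ (t - 2)) := lintegral_mono key
    _ = (∫⁻ x, ∫⁻ y, k (x - y) ^ m * f y ^ s) * (I * J ^ (t - 2)) :=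
        lintegral_mul_const _ hprod.lintegral_prod_right'
    _ = (I * J) * (I * J ^ (t - 2)) := by
        congr 1
        rw [lintegral_lintegral_swap hprod.aemeasurable]
        have : ∀ y : E3, ∫⁻ x, k (x - y) ^ m * f y ^ s = I * f y ^ s := by
          intro y
          have hm' : Measurable fun x : E3 => k (x - y) ^ m :=
            (hk.comp (by fun_prop : Measurable fun x : E3 => x - y)).pow_const m
          rw [lintegral_mul_const _ hm', hIy]
        simp_rw [this]
        rw [lintegral_const_mul _ (hf.pow_const s)]
    _ = I ^ (2:ℕ) * (J ^ (1:ℝ) * J ^ (t - 2)) := by rw [ENNReal.rpow_one]; ring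
    _ = _ := by
        rw [← ENNReal.rpow_add_of_nonneg _ _ (by norm_num) (by linarith)]
        congr 2; ring

lemma piece_aux (q q' θ : ℝ) (hq : 2 < q) (hq' : q' = q / (q - 1)) (hθ : 0 < θ) (hθ1 : θ ≤ 1)
    (Γ : E3 → ℝ) (hΓ_meas : Measurable Γ) (hΓ_pos : ∀ x, 0 < Γ x)
    (k : E3 → ℝ) (hk : Measurable k)
    (hkI : ∫⁻ x, ‖k x‖ₑ ^ (q / θ / 2) < ⊤)
    (c₁ c₂ : ℝ≥0∞) (hc₁ : c₁ ≠ ⊤) (hc₂ : c₂ ≠ ⊤)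
    (H₁ : ∀ f : E3 → ℝ≥0∞, Measurable f → ∫⁻ x, f x ^ (q / θ / (q / θ - 1)) ≤
      c₁ * (∫⁻ x, ENNReal.ofReal (Γ x) ^ (1 - q') * f x ^ q') ^ ((q - 1) / (q - θ)))
    (H₂ : ∀ f : E3 → ℝ≥0∞, Measurable f → ∫⁻ x, ENNReal.ofReal (Γ x) * f x ^ q ≤
      c₂ * (∫⁻ x, f x ^ (q / θ)) ^ θ) :
    ∃ c : ℝ≥0∞, c ≠ ⊤ ∧ ∀ P : E3 → E3, Measurable P →
      (∫⁻ x, ENNReal.ofReal (Γ x ^ (1 - q') * ‖P x‖ ^ q')) ^ (1 / q') < ⊤ →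
      (∀ᵐ x ∂volume, Integrable (fun y => k (x - y) • P y) volume) ∧
      Measurable (fun x => ∫ y, k (x - y) • P y) ∧
      (∫⁻ x, ENNReal.ofReal ((Γ x ^ (1 / q) * ‖∫ y, k (x - y) • P y‖) ^ q)) ^ (1 / q) ≤
        c * (∫⁻ x, ENNReal.ofReal (Γ x ^ (1 - q') * ‖P x‖ ^ q')) ^ (1 / q') := by
  set t := q / θ with ht
  set I := ∫⁻ x, ‖k x‖ₑ ^ (t / 2) with hI
  have hq0 : 0 < q := by linarith
  have hq'0 : 0 < q' := by rw [hq']; exact div_pos hq0 (by linarith)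
  have hqθ : 0 < q - θ := by linarith
  have htq : q ≤ t := by rw [ht, le_div_iff₀ hθ]; nlinarith
  have ht2 : 2 < t := by linarith
  have ht0 : 0 < t := by linarith
  refine ⟨(c₂ * (I ^ (2:ℕ) * c₁ ^ (t - 1)) ^ θ) ^ (1 / q), ?_, ?_⟩
  · apply ENNReal.rpow_ne_top_of_nonneg (by positivity)
    apply ENNReal.mul_ne_top hc₂
    apply ENNReal.rpow_ne_top_of_nonneg hθ.le
    apply ENNReal.mul_ne_top (ENNReal.pow_ne_top hkI.ne)
    exact ENNReal.rpow_ne_top_of_nonneg (by linarith) hc₁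
  intro P hP hA
  have hAeq : ∫⁻ x, ENNReal.ofReal (Γ x ^ (1 - q') * ‖P x‖ ^ q') =
      ∫⁻ x, ENNReal.ofReal (Γ x) ^ (1 - q') * ‖P x‖ₑ ^ q' := by
    apply lintegral_congr
    intro x
    rw [ENNReal.ofReal_mul (Real.rpow_nonneg (hΓ_pos x).le _), ENNReal.ofReal_rpow_of_pos (hΓ_pos x),
      ← ofReal_norm, ENNReal.ofReal_rpow_of_nonneg (norm_nonneg _) hq'0.le]
  rw [hAeq] at hA ⊢
  set A := ∫⁻ x, ENNReal.ofReal (Γ x) ^ (1 - q') * ‖P x‖ₑ ^ q' with hAdef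
  have hAt : A ≠ ⊤ := by
    intro h
    rw [h, ENNReal.top_rpow_of_pos (by positivity)] at hA
    exact lt_irrefl _ hA
  set F : E3 → ℝ≥0∞ := fun x => ∫⁻ y, ‖k (x - y)‖ₑ * ‖P y‖ₑ with hF
  have hFm : Measurable F := by
    have : Measurable fun z : E3 × E3 => ‖k (z.1 - z.2)‖ₑ * ‖P z.2‖ₑ :=
      (hk.comp (measurable_fst.sub measurable_snd)).enorm.mul (hP.comp measurable_snd).enorm
    exact this.lintegral_prod_right'
  have hY : ∫⁻ x, F x ^ t ≤ I ^ (2:ℕ) * (c₁ * A ^ ((q - 1) / (q - θ))) ^ (t - 1) :=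
    (young_aux t ht2 _ _ hk.enorm hP.enorm).trans (by
      gcongr
      · linarith
      · exact H₁ _ hP.enorm)
  have hYt : ∫⁻ x, F x ^ t ≠ ⊤ := by
    refine ne_top_of_le_ne_top ?_ hY
    apply ENNReal.mul_ne_top (ENNReal.pow_ne_top hkI.ne)
    apply ENNReal.rpow_ne_top_of_nonneg (by linarith)
    apply ENNReal.mul_ne_top hc₁
    exact ENNReal.rpow_ne_top_of_nonneg (div_nonneg (by linarith) hqθ.le) hAt
  have hfin : ∀ᵐ x ∂volume, F x < ⊤ := by
    filter_upwards [ae_lt_top (hFm.pow_const t) hYt] with x hx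
    by_contra h
    rw [not_lt, top_le_iff] at h
    rw [h, ENNReal.top_rpow_of_pos ht0] at hx
    exact lt_irrefl _ hx
  refine ⟨?_, ?_, ?_⟩
  · filter_upwards [hfin] with x hx
    refine ⟨?_, ?_⟩
    · exact ((hk.comp (by fun_prop : Measurable fun y : E3 => x - y)).smul hP).aestronglyMeasurable
    · rw [hasFiniteIntegral_iff_enorm]
      simpa [enorm_smul] using hx
  · have : StronglyMeasurable fun z : E3 × E3 => k (z.1 - z.2) • P z.2 :=
      ((hk.comp (measurable_fst.sub measurable_snd)).smul (hP.comp measurable_snd)).stronglyMeasurable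
    exact this.integral_prod_right'.measurable
  · have h1 : ∫⁻ x, ENNReal.ofReal ((Γ x ^ (1 / q) * ‖∫ y, k (x - y) • P y‖) ^ q) ≤
        ∫⁻ x, ENNReal.ofReal (Γ x) * F x ^ q := by
      apply lintegral_mono
      intro x
      have hg := hΓ_pos x
      beta_reduce
      rw [Real.mul_rpow (Real.rpow_nonneg hg.le _) (norm_nonneg _), ← Real.rpow_mul hg.le,
        one_div_mul_cancel hq0.ne', Real.rpow_one, ENNReal.ofReal_mul hg.le]
      gcongr
      rw [← ENNReal.ofReal_rpow_of_nonneg (norm_nonneg _) hq0.le, ofReal_norm]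
      gcongr
      refine (enorm_integral_le_lintegral_enorm _).trans ?_
      simp [enorm_smul, hF]
    calc _ ≤ (c₂ * (I ^ (2:ℕ) * (c₁ * A ^ ((q - 1) / (q - θ))) ^ (t - 1)) ^ θ) ^ (1 / q) := by
          gcongr
          refine h1.trans ((H₂ F hFm).trans ?_)
          gcongr
      _ = _ := by
          rw [ENNReal.mul_rpow_of_nonneg c₁ _ (by linarith), ← mul_assoc,
            ENNReal.mul_rpow_of_nonneg (I ^ 2 * _) _ hθ.le, ← mul_assoc,
            ENNReal.mul_rpow_of_nonneg (c₂ * _) _ (by positivity)]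
          simp only [← ENNReal.rpow_mul]
          congr 2
          rw [hq', ht]
          have : q - 1 ≠ 0 := by linarith
          field_simp

lemma near_aux (m : ℝ) (hm0 : 0 < m) (hm : m < 3) :
    ∫⁻ x : E3, ‖(Metric.ball (0:E3) 1).indicator (fun z => (4 * Real.pi * ‖z‖)⁻¹) x‖ₑ ^ m < ⊤ := by
  have h := integrableOn_ball_of_norm_le_rpow (μ := (volume : Measure E3)) (r := 1)
    (f := fun x : E3 => ‖x‖ ^ (-m)) (C := 1) (α := m) (by simp) (by simpa using hm)
    (Filter.Eventually.of_forall fun x => by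
      rw [Real.norm_of_nonneg (Real.rpow_nonneg (norm_nonneg _) _), one_mul])
    (measurable_norm.pow_const (-m)).aestronglyMeasurable
  have h2 := h.2
  rw [hasFiniteIntegral_iff_enorm] at h2
  refine lt_of_le_of_lt ?_ h2
  rw [← lintegral_indicator measurableSet_ball]
  apply lintegral_mono
  intro x
  by_cases hx : x ∈ Metric.ball (0:E3) 1
  · simp only [indicator_of_mem hx]
    rw [← ofReal_norm, ENNReal.ofReal_rpow_of_nonneg (norm_nonneg _) hm0.le, ← ofReal_norm]
    apply ENNReal.ofReal_le_ofReal
    rw [Real.norm_of_nonneg (Real.rpow_nonneg (norm_nonneg _) _),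
      Real.rpow_neg (by positivity), ← Real.inv_rpow (by positivity)]
    apply Real.rpow_le_rpow (norm_nonneg _) _ hm0.le
    rw [Real.norm_of_nonneg (by positivity)]
    rcases (norm_nonneg x).eq_or_lt with h0 | h0
    · simp [← h0]
    apply inv_anti₀ h0
    nlinarith [Real.pi_gt_three]
  · simp only [indicator_of_notMem hx]
    simp [hm0]

lemma far_aux (m : ℝ) (hm : 3 < m) :
    ∫⁻ x : E3, ‖(Metric.ball (0:E3) 1)ᶜ.indicator (fun z => (4 * Real.pi * ‖z‖)⁻¹) x‖ₑ ^ m < ⊤ := by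
  have hm0 : 0 < m := by linarith
  refine lt_of_le_of_lt (lintegral_mono (g := fun x : E3 => ENNReal.ofReal ((1 + ‖x‖) ^ (-m))) ?_)
    (finite_integral_one_add_norm (by simpa using hm))
  intro x
  by_cases hx : x ∈ (Metric.ball (0:E3) 1)ᶜ
  · have hx1 : 1 ≤ ‖x‖ := by simpa using hx
    simp only [indicator_of_mem hx]
    rw [← ofReal_norm, ENNReal.ofReal_rpow_of_nonneg (norm_nonneg _) hm0.le]
    apply ENNReal.ofReal_le_ofReal
    rw [Real.rpow_neg (by positivity), ← Real.inv_rpow (by positivity)]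
    apply Real.rpow_le_rpow (norm_nonneg _) _ hm0.le
    rw [Real.norm_of_nonneg (by positivity)]
    apply inv_anti₀ (by positivity)
    nlinarith [Real.pi_gt_three]
  · simp only [indicator_of_notMem hx]
    simp [hm0]

lemma gamma_rpow (q q' b : ℝ) (hq : 2 < q) (hq' : q' = q / (q - 1)) (g : ℝ) (hg : 0 < g)
    (f : ℝ≥0∞) (s a : ℝ) (ha : 0 ≤ a) (hs : q' * a = s) (hb : (1 - q') * a + b = 0) :
    f ^ s = (ENNReal.ofReal g ^ (1 - q') * f ^ q') ^ a * ENNReal.ofReal g ^ b := by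
  have h0 : ENNReal.ofReal g ≠ 0 := by simpa using hg
  rw [ENNReal.mul_rpow_of_nonneg _ _ ha, ← ENNReal.rpow_mul, ← ENNReal.rpow_mul, hs,
    mul_right_comm, ← ENNReal.rpow_add _ _ h0 ENNReal.ofReal_ne_top, hb]
  simp

theorem newtonian_potential_Z_to_Zstar_bound
    (α p q p' q' C : ℝ) (hα0 : 0 < α) (hα3 : α < 3)
    (hp2 : 2 < p) (hp6 : p < 6) (hq : max 2 (6 - 2 * α) < q)
    (hp' : p' = p / (p - 1)) (hq' : q' = q / (q - 1)) (hC : 0 < C)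
    (Γ : EuclideanSpace ℝ (Fin 3) → ℝ)
    (hΓ_meas : Measurable Γ) (hΓ_pos : ∀ x, 0 < Γ x)
    (hΓ_dec : ∀ᵐ x ∂volume, Γ x ≤ C * (1 + ‖x‖) ^ (-α))
    (K : EuclideanSpace ℝ (Fin 3) → ℝ)
    (hK : ∀ z, K z = (4 * Real.pi * ‖z‖)⁻¹) :
    ∃ C'' : ℝ, 0 < C'' ∧
      ∀ P : EuclideanSpace ℝ (Fin 3) → EuclideanSpace ℝ (Fin 3), Measurable P →
        (∫⁻ x, ENNReal.ofReal (Γ x ^ (1 - p') * ‖P x‖ ^ p')) ^ (1 / p') < ⊤ →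
        (∫⁻ x, ENNReal.ofReal (Γ x ^ (1 - q') * ‖P x‖ ^ q')) ^ (1 / q') < ⊤ →
        (∀ᵐ x ∂volume, Integrable (fun y => K (x - y) • P y) volume) ∧
        ∃ E₁ E₂ : EuclideanSpace ℝ (Fin 3) → EuclideanSpace ℝ (Fin 3),
          Measurable E₁ ∧ Measurable E₂ ∧
          (∀ᵐ x ∂volume, (∫ y, K (x - y) • P y) = E₁ x + E₂ x) ∧
          (∫⁻ x, ENNReal.ofReal ((Γ x ^ (1 / p) * ‖E₁ x‖) ^ p)) ^ (1 / p)
            + (∫⁻ x, ENNReal.ofReal ((Γ x ^ (1 / q) * ‖E₂ x‖) ^ q)) ^ (1 / q)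
          ≤ ENNReal.ofReal C''
            * ((∫⁻ x, ENNReal.ofReal (Γ x ^ (1 - p') * ‖P x‖ ^ p')) ^ (1 / p')
              + (∫⁻ x, ENNReal.ofReal (Γ x ^ (1 - q') * ‖P x‖ ^ q')) ^ (1 / q')) := by
  obtain ⟨hq2, hqα⟩ := max_lt_iff.mp hq
  have hγm : Measurable fun x => ENNReal.ofReal (Γ x) := hΓ_meas.ennreal_ofReal
  have hγC : ∀ᵐ x ∂volume, ENNReal.ofReal (Γ x) ≤ ENNReal.ofReal C := by
    filter_upwards [hΓ_dec] with x hx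
    apply ENNReal.ofReal_le_ofReal
    refine hx.trans ?_
    have : (1 + ‖x‖) ^ (-α) ≤ 1 :=
      Real.rpow_le_one_of_one_le_of_nonpos (by linarith [norm_nonneg x]) (by linarith)
    nlinarith
  obtain ⟨θ, hθl, hθr⟩ : ∃ θ, 1 - α / 3 < θ ∧ θ < min 1 (q / 6) :=
    exists_between (lt_min (by linarith) (by linarith))
  obtain ⟨hθ1, hθq⟩ := lt_min_iff.mp hθr
  have hθ0 : 0 < θ := by linarith
  have h1θ : 0 < 1 - θ := by linarith
  have hqθ : 0 < q - θ := by linarith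
  have hq1 : 0 < q - 1 := by linarith
  have hp1 : 0 < p - 1 := by linarith
  have hG : ∫⁻ x, ENNReal.ofReal (Γ x) ^ (1 / (1 - θ)) < ⊤ := by
    have hr : (3:ℝ) < α * (1 / (1 - θ)) := by
      rw [mul_one_div, lt_div_iff₀ h1θ]; linarith
    have hfin := finite_integral_one_add_norm (μ := (volume : Measure E3))
      (r := α * (1 / (1 - θ))) (by simpa using hr)
    refine lt_of_le_of_lt (lintegral_mono_ae (g := fun x : E3 => ENNReal.ofReal (C ^ (1 / (1 - θ))) *
      ENNReal.ofReal ((1 + ‖x‖) ^ (-(α * (1 / (1 - θ)))))) ?_) ?_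
    · filter_upwards [hΓ_dec] with x hx
      rw [ENNReal.ofReal_rpow_of_pos (hΓ_pos x), ← ENNReal.ofReal_mul (by positivity)]
      apply ENNReal.ofReal_le_ofReal
      calc _ ≤ _ := Real.rpow_le_rpow (hΓ_pos x).le hx (by positivity)
        _ = _ := by
          rw [Real.mul_rpow hC.le (by positivity), ← Real.rpow_mul (by positivity)]
          congr 2; ring
    · rw [lintegral_const_mul' _ _ ENNReal.ofReal_ne_top]
      exact ENNReal.mul_lt_top ENNReal.ofReal_lt_top hfin
  have hN : Measurable fun z : E3 => (4 * Real.pi * ‖z‖)⁻¹ := by fun_prop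
  set k₁ : E3 → ℝ := (Metric.ball (0:E3) 1).indicator (fun z => (4 * Real.pi * ‖z‖)⁻¹) with hk₁
  set k₂ : E3 → ℝ := (Metric.ball (0:E3) 1)ᶜ.indicator (fun z => (4 * Real.pi * ‖z‖)⁻¹) with hk₂
  have hKk : ∀ z, K z = k₁ z + k₂ z := by
    intro z
    rw [hK, hk₁, hk₂, Set.indicator_self_add_compl_apply]
  obtain ⟨c, hc, hcP⟩ := piece_aux p p' 1 hp2 hp' one_pos le_rfl Γ hΓ_meas hΓ_pos k₁
    (hN.indicator measurableSet_ball)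
    (near_aux _ (by positivity) (by linarith)) (ENNReal.ofReal C ^ (1 / (p - 1))) (ENNReal.ofReal C)
    (ENNReal.rpow_ne_top_of_nonneg (by positivity) ENNReal.ofReal_ne_top) ENNReal.ofReal_ne_top
    (by
      intro f hf
      rw [div_self hp1.ne', ENNReal.rpow_one, ← lintegral_const_mul' _ _
        (ENNReal.rpow_ne_top_of_nonneg (by positivity) ENNReal.ofReal_ne_top)]
      apply lintegral_mono_ae
      filter_upwards [hγC] with x hx
      rw [gamma_rpow p p' (1 / (p - 1)) hp2 hp' (Γ x) (hΓ_pos x) (f x) (p / 1 / (p / 1 - 1)) 1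
        zero_le_one (by rw [hp']; simp) (by rw [hp']; field_simp; ring), ENNReal.rpow_one, mul_comm]
      gcongr)
    (by
      intro f hf
      rw [ENNReal.rpow_one, ← lintegral_const_mul' _ _ ENNReal.ofReal_ne_top]
      apply lintegral_mono_ae
      filter_upwards [hγC] with x hx
      rw [div_one]
      gcongr)
  have hmq : 3 < q / θ / 2 := by
    rw [div_div, lt_div_iff₀ (by positivity)]; linarith
  obtain ⟨d, hd, hdP⟩ := piece_aux q q' θ hq2 hq' hθ0 hθ1.le Γ hΓ_meas hΓ_pos k₂
    (hN.indicator measurableSet_ball.compl) (far_aux _ hmq)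
    ((∫⁻ x, ENNReal.ofReal (Γ x) ^ (1 / (1 - θ))) ^ ((1 - θ) / (q - θ)))
    ((∫⁻ x, ENNReal.ofReal (Γ x) ^ (1 / (1 - θ))) ^ (1 - θ))
    (ENNReal.rpow_ne_top_of_nonneg (by positivity) hG.ne)
    (ENNReal.rpow_ne_top_of_nonneg (by positivity) hG.ne)
    (by
      intro f hf
      have h1 : ∀ x, f x ^ (q / θ / (q / θ - 1)) =
          (ENNReal.ofReal (Γ x) ^ (1 - q') * f x ^ q') ^ ((q - 1) / (q - θ)) *
          (ENNReal.ofReal (Γ x) ^ (1 / (1 - θ))) ^ ((1 - θ) / (q - θ)) := by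
        intro x
        rw [gamma_rpow q q' (1 / (q - θ)) hq2 hq' (Γ x) (hΓ_pos x) (f x) (q / θ / (q / θ - 1))
          ((q - 1) / (q - θ)) (by positivity)
          (by
            have : q / θ - 1 = (q - θ) / θ := by field_simp
            rw [hq', this]; field_simp)
          (by rw [hq']; field_simp; ring), ← ENNReal.rpow_mul]
        congr 2; field_simp
      simp_rw [h1]
      rw [mul_comm]
      apply ENNReal.lintegral_mul_norm_pow_le
      · exact ((hγm.pow_const _).mul (hf.pow_const _)).aemeasurable
      · exact (hγm.pow_const _).aemeasurable
      · positivity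
      · positivity
      · field_simp; ring)
    (by
      intro f hf
      have h1 : ∀ x, ENNReal.ofReal (Γ x) * f x ^ q =
          (ENNReal.ofReal (Γ x) ^ (1 / (1 - θ))) ^ (1 - θ) * (f x ^ (q / θ)) ^ θ := by
        intro x
        rw [← ENNReal.rpow_mul, ← ENNReal.rpow_mul, div_mul_cancel₀ _ hθ0.ne',
          div_mul_cancel₀ _ h1θ.ne', ENNReal.rpow_one]
      simp_rw [h1]
      apply ENNReal.lintegral_mul_norm_pow_le
      · exact (hγm.pow_const _).aemeasurable
      · exact (hf.pow_const _).aemeasurable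
      · exact h1θ.le
      · exact hθ0.le
      · ring)
  refine ⟨c.toReal + d.toReal + 1, by positivity, ?_⟩
  intro P hP hA hB
  obtain ⟨i₁, m₁, b₁⟩ := hcP P hP hA
  obtain ⟨i₂, m₂, b₂⟩ := hdP P hP hB
  have hsum : ∀ x y, K (x - y) • P y = k₁ (x - y) • P y + k₂ (x - y) • P y := by
    intro x y
    rw [hKk, add_smul]
  refine ⟨?_, _, _, m₁, m₂, ?_, ?_⟩
  · filter_upwards [i₁, i₂] with x h1 h2
    simp_rw [hsum]
    exact h1.add h2
  · filter_upwards [i₁, i₂] with x h1 h2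
    simp_rw [hsum]
    exact integral_add h1 h2
  · have hc' : c ≤ ENNReal.ofReal (c.toReal + d.toReal + 1) := by
      rw [← ENNReal.ofReal_toReal hc, ENNReal.toReal_ofReal ENNReal.toReal_nonneg]
      apply ENNReal.ofReal_le_ofReal
      linarith [ENNReal.toReal_nonneg (a := d)]
    have hd' : d ≤ ENNReal.ofReal (c.toReal + d.toReal + 1) := by
      rw [← ENNReal.ofReal_toReal hd, ENNReal.toReal_ofReal ENNReal.toReal_nonneg]
      apply ENNReal.ofReal_le_ofReal
      linarith [ENNReal.toReal_nonneg (a := c)]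
    rw [mul_add]
    exact add_le_add (b₁.trans (mul_le_mul_left hc' _)) (b₂.trans (mul_le_mul_left hd' _))
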